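/- Let 0 ≤ d < 1 and let Ω ⊆ (0, π/2) have upper Minkowski dimension at most d. Set τ = 2/(1−d)² − 2. Then for every ε > 0 there exists a constant C > 0 such that for every N ≥ 2 there is a set P of N points in [0,1]² with the property that for every rectangle R ∈ A_Ω with R ⊆ [0,1]², one has |#(P ∩ R) − N·area(R)| ≤ C·N^{τ/(2(τ+1)) + ε}. In other words, D_Ω(N) ≲ N^{τ/(2(τ+1)) + ε}. -/

import Mathlib

open MeasureTheory

noncomputable section

/-- Rotation of the plane by angle `φ`. -/
def rot (φ : ℝ) (x : ℝ × ℝ) : ℝ × ℝ :=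
  (x.1 * Real.cos φ - x.2 * Real.sin φ, x.1 * Real.sin φ + x.2 * Real.cos φ)

/-- The rectangle obtained by rotating `[0,w] × [0,h]` by angle `φ` and translating by `p`. -/
def rect (φ : ℝ) (p : ℝ × ℝ) (w h : ℝ) : Set (ℝ × ℝ) :=
  (fun x => p + rot φ x) '' (Set.Icc 0 w ×ˢ Set.Icc 0 h)

/-- The unit square `[0,1]²`. -/
def unitSq : Set (ℝ × ℝ) := Set.Icc (0:ℝ) 1 ×ˢ Set.Icc (0:ℝ) 1

/-- `Ω` has upper Minkowski dimension at most `d`: for every `s > d` there is a constant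
`C_s` such that for every `0 < δ < 1` the set `Ω` can be covered by at most `C_s δ^{-s}`
intervals of length `δ`. -/
def MinkowskiBound (Ω : Set ℝ) (d : ℝ) : Prop :=
  ∀ s : ℝ, d < s → ∃ Cs : ℝ, ∀ δ : ℝ, 0 < δ → δ < 1 →
    ∃ F : Finset ℝ, (F.card : ℝ) ≤ Cs * δ ^ (-s) ∧
      Ω ⊆ ⋃ x ∈ F, Set.Icc x (x + δ)

/-- The sawtooth function, with mean zero over a period. -/
def sawtooth (x : ℝ) : ℝ := (⌊x⌋ : ℝ) - x + 1 / 2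

lemma sum_emod_range (p m : ℤ) (q : ℕ) (hq : 0 < q) (hpq : IsCoprime p (q : ℤ)) :
    ∑ n ∈ Finset.range q, (((n : ℤ) * p + m) % (q : ℤ)) = ∑ n ∈ Finset.range q, (n : ℤ) := by
  have hq' : (0 : ℤ) < q := by exact_mod_cast hq
  have hnn : ∀ n : ℕ, 0 ≤ ((n : ℤ) * p + m) % (q : ℤ) := fun n => Int.emod_nonneg _ hq'.ne'
  have hlt : ∀ n : ℕ, ((n : ℤ) * p + m) % (q : ℤ) < q := fun n => Int.emod_lt_of_pos _ hq'
  have hinj : Set.InjOn (fun n : ℕ => (((n : ℤ) * p + m) % (q : ℤ)).toNat) (Finset.range q) := by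
    intro x hx y hy hxy
    simp only [Finset.coe_range, Set.mem_Iio] at hx hy
    have h1 : ((x : ℤ) * p + m) % (q : ℤ) = ((y : ℤ) * p + m) % (q : ℤ) := by
      have := hnn x
      have := hnn y
      simp only at hxy
      omega
    have h2 : (q : ℤ) ∣ ((x : ℤ) - y) * p := by
      have h := Int.ModEq.dvd (show ((y : ℤ) * p + m) ≡ ((x : ℤ) * p + m) [ZMOD q] from h1.symm)
      convert h using 1
      ring
    have h3 : (q : ℤ) ∣ (x : ℤ) - y := hpq.symm.dvd_of_dvd_mul_right h2
    have h4 := Int.eq_zero_of_abs_lt_dvd h3 (by rw [abs_lt]; constructor <;> omega)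
    omega
  have himg : (Finset.range q).image (fun n : ℕ => (((n : ℤ) * p + m) % (q : ℤ)).toNat)
      = Finset.range q := by
    apply Finset.eq_of_subset_of_card_le
    · intro k hk
      simp only [Finset.mem_image, Finset.mem_range] at hk ⊢
      obtain ⟨n, -, rfl⟩ := hk
      have := hnn n
      have := hlt n
      omega
    · rw [Finset.card_image_of_injOn hinj]
  conv_rhs => rw [← himg]
  rw [Finset.sum_image hinj]
  refine Finset.sum_congr rfl fun n _ => ?_
  rw [Int.toNat_of_nonneg (hnn n)]

lemma floor_add_div (k : ℤ) (y : ℝ) (q : ℕ) :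
    ⌊((k : ℝ) + y) / q⌋ = (k + ⌊y⌋) / (q : ℤ) := by
  rw [← Int.floor_intCast_add, ← Int.floor_div_natCast]

lemma sum_floor_progression (p : ℤ) (q : ℕ) (hq : 0 < q) (hpq : IsCoprime p (q : ℤ)) (y : ℝ) :
    ∑ n ∈ Finset.range q, (⌊((n : ℝ) * p + y) / q⌋ : ℝ) =
      ∑ n ∈ Finset.range q, ((n : ℝ) * p / q) + ⌊y⌋ - ((q : ℝ) - 1) / 2 := by
  have hqR : (0 : ℝ) < q := by exact_mod_cast hq
  have h1 : ∀ n ∈ Finset.range q, (⌊((n : ℝ) * p + y) / q⌋ : ℝ) =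
      (n : ℝ) * p / q + ⌊y⌋ / q - ((((n : ℤ) * p + ⌊y⌋) % (q : ℤ) : ℤ) : ℝ) / q := by
    intro n _
    have h := floor_add_div ((n : ℤ) * p) y q
    push_cast at h
    rw [h]
    have h2 := Int.emod_add_mul_ediv ((n : ℤ) * p + ⌊y⌋) q
    have h3 : ((((n : ℤ) * p + ⌊y⌋) % (q : ℤ) : ℤ) : ℝ)
      + q * ((((n : ℤ) * p + ⌊y⌋) / (q : ℤ) : ℤ) : ℝ) = (n : ℝ) * p + ⌊y⌋ := by
      exact_mod_cast h2
    field_simp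
    linarith
  have h4 : ((∑ n ∈ Finset.range q, (n : ℤ) : ℤ) : ℝ) = (q : ℝ) * (q - 1) / 2 := by
    have := Finset.sum_range_id_mul_two q
    have h5 : ((∑ n ∈ Finset.range q, n : ℕ) : ℝ) * 2 = q * (q - 1) := by
      rw [← Nat.cast_ofNat, ← Nat.cast_mul, this]
      rw [Nat.cast_mul, Nat.cast_sub hq]
      simp
    push_cast at h5 ⊢
    linarith
  have h6 : ∑ n ∈ Finset.range q, ((((n : ℤ) * p + ⌊y⌋) % (q : ℤ) : ℤ) : ℝ) / q =
      ((q : ℝ) - 1) / 2 := by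
    rw [← Finset.sum_div, ← Int.cast_sum, sum_emod_range p _ q hq hpq, h4]
    field_simp
  rw [Finset.sum_congr rfl h1, Finset.sum_sub_distrib, Finset.sum_add_distrib, h6,
    Finset.sum_const, Finset.card_range, nsmul_eq_mul, mul_div_cancel₀ (⌊y⌋ : ℝ) hqR.ne']

lemma abs_sum_sawtooth_block (θ : ℝ) (p : ℤ) (q : ℕ) (hq : 0 < q) (hpq : IsCoprime p (q : ℤ))
    (h : |θ - p / q| * q ^ 2 ≤ 1) (β : ℝ) :
    |∑ n ∈ Finset.range q, sawtooth (n * θ + β)| ≤ 3 := by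
  have hqR : (0 : ℝ) < q := by exact_mod_cast hq
  have hclose : ∀ n ∈ Finset.range q, |n * θ - (n : ℝ) * p / q| ≤ 1 / q := by
    intro n hn
    have hn' : (n : ℝ) ≤ q := by exact_mod_cast (Finset.mem_range.1 hn).le
    have : n * θ - (n : ℝ) * p / q = n * (θ - p / q) := by ring
    rw [this, abs_mul, Nat.abs_cast, le_div_iff₀ hqR]
    calc (n : ℝ) * |θ - p / q| * q ≤ q * |θ - p / q| * q := by gcongr
      _ = |θ - p / q| * q ^ 2 := by ring
      _ ≤ 1 := h
  have hone : ∑ n ∈ Finset.range q, (1 / (q : ℝ)) = 1 := by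
    rw [Finset.sum_const, Finset.card_range, nsmul_eq_mul]; field_simp
  have hhalf : ∑ n ∈ Finset.range q, (1 / 2 : ℝ) = q / 2 := by
    rw [Finset.sum_const, Finset.card_range, nsmul_eq_mul]; ring
  have hβ : ∑ n ∈ Finset.range q, β = q * β := by
    rw [Finset.sum_const, Finset.card_range, nsmul_eq_mul]
  have hup : ∑ n ∈ Finset.range q, (⌊n * θ + β⌋ : ℝ) ≤
      ∑ n ∈ Finset.range q, (⌊((n : ℝ) * p + (q * β + 1)) / q⌋ : ℝ) := by
    refine Finset.sum_le_sum fun n hn => ?_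
    have h1 := (abs_le.1 (hclose n hn)).2
    have h2 : ((n : ℝ) * p + (q * β + 1)) / q = (n : ℝ) * p / q + β + 1 / q := by field_simp; ring
    rw [h2]
    exact Int.cast_le.2 (Int.floor_le_floor (by linarith))
  have hlow : ∑ n ∈ Finset.range q, (⌊((n : ℝ) * p + (q * β - 1)) / q⌋ : ℝ) ≤
      ∑ n ∈ Finset.range q, (⌊n * θ + β⌋ : ℝ) := by
    refine Finset.sum_le_sum fun n hn => ?_
    have h1 := (abs_le.1 (hclose n hn)).1
    have h2 : ((n : ℝ) * p + (q * β - 1)) / q = (n : ℝ) * p / q + β - 1 / q := by field_simp; ring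
    rw [h2]
    exact Int.cast_le.2 (Int.floor_le_floor (by linarith))
  rw [sum_floor_progression p q hq hpq] at hup hlow
  have hs1 : ∑ n ∈ Finset.range q, (n * θ) ≤ ∑ n ∈ Finset.range q, ((n : ℝ) * p / q) + 1 := by
    rw [← hone, ← Finset.sum_add_distrib]
    exact Finset.sum_le_sum fun n hn => by linarith [(abs_le.1 (hclose n hn)).2]
  have hs2 : ∑ n ∈ Finset.range q, ((n : ℝ) * p / q) ≤ ∑ n ∈ Finset.range q, (n * θ) + 1 := by
    rw [← hone, ← Finset.sum_add_distrib]
    exact Finset.sum_le_sum fun n hn => by linarith [(abs_le.1 (hclose n hn)).1]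
  have hf1 := Int.floor_le ((q : ℝ) * β + 1)
  have hf2 := Int.lt_floor_add_one ((q : ℝ) * β - 1)
  unfold sawtooth
  rw [Finset.sum_add_distrib, Finset.sum_sub_distrib, Finset.sum_add_distrib, hhalf, hβ, abs_le]
  constructor <;> linarith

lemma abs_sum_sawtooth_mul_add (θ : ℝ) (p : ℤ) (q : ℕ) (hq : 0 < q) (hpq : IsCoprime p (q : ℤ))
    (h : |θ - p / q| * q ^ 2 ≤ 1) (r : ℕ) (B : ℝ)
    (hB : ∀ β, |∑ n ∈ Finset.range r, sawtooth (n * θ + β)| ≤ B) (k : ℕ) (β : ℝ) :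
    |∑ n ∈ Finset.range (q * k + r), sawtooth (n * θ + β)| ≤ 3 * k + B := by
  induction k generalizing β with
  | zero => simpa using hB β
  | succ k ih =>
    have e : q * (k + 1) + r = q + (q * k + r) := by ring
    rw [e, Finset.sum_range_add]
    have e2 : ∀ x : ℕ, sawtooth (((q + x : ℕ) : ℝ) * θ + β) = sawtooth (x * θ + (q * θ + β)) := by
      intro x; congr 1; push_cast; ring
    simp only [e2]
    have h1 := abs_sum_sawtooth_block θ p q hq hpq h β
    have h2 := ih (q * θ + β)
    refine (abs_add_le _ _).trans ?_
    push_cast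
    linarith

/-- Lower bound for the approximation of `θ` by rationals, with exponent `1 + τ`. -/
def DiophantineType (κ τ θ : ℝ) : Prop :=
  ∀ (p : ℤ) (q : ℕ), 0 < q → κ * (q : ℝ) ^ (-(1 + τ)) ≤ |q * θ - p|

lemma nat_div_le_of_approx {κ τ θ : ℝ} (hκ : 0 < κ) (hκ1 : κ ≤ 1) (hτ : 0 < τ)
    (hθ : DiophantineType κ τ θ) {M q : ℕ} (hM : 0 < M) (hq : 0 < q) (p : ℤ)
    (h : |q * θ - p| ≤ 1 / M) : (M : ℝ) / q ≤ κ⁻¹ * (M : ℝ) ^ (τ / (1 + τ)) := by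
  have hMR : (0 : ℝ) < M := by exact_mod_cast hM
  have hqR : (0 : ℝ) < q := by exact_mod_cast hq
  have h1 := (hθ p q hq).trans h
  rw [Real.rpow_neg hqR.le, ← div_eq_mul_inv, div_le_div_iff₀ (by positivity) hMR, one_mul] at h1
  have h3 : (κ * M) ^ (1 / (1 + τ)) ≤ q := by
    calc (κ * M) ^ (1 / (1 + τ)) ≤ ((q : ℝ) ^ (1 + τ)) ^ (1 / (1 + τ)) := by gcongr
      _ = q := by rw [← Real.rpow_mul hqR.le, mul_one_div_cancel (by positivity), Real.rpow_one]
  have h4 : κ ≤ κ ^ (1 / (1 + τ)) := by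
    conv_lhs => rw [← Real.rpow_one κ]
    exact Real.rpow_le_rpow_of_exponent_ge hκ hκ1 (by rw [div_le_one (by positivity)]; linarith)
  have h5 : (M : ℝ) = M ^ (1 / (1 + τ)) * (M : ℝ) ^ (τ / (1 + τ)) := by
    rw [← Real.rpow_add hMR, ← add_div, div_self (by positivity), Real.rpow_one]
  rw [Real.mul_rpow hκ.le hMR.le] at h3
  rw [div_le_iff₀ hqR]
  calc (M : ℝ) = M ^ (1 / (1 + τ)) * (M : ℝ) ^ (τ / (1 + τ)) := h5
    _ = κ⁻¹ * M ^ (τ / (1 + τ)) * (κ * (M : ℝ) ^ (1 / (1 + τ))) := by field_simp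
    _ ≤ κ⁻¹ * M ^ (τ / (1 + τ)) * q := by
      gcongr
      exact le_trans (by gcongr) h3

lemma exists_abs_sum_sawtooth_le {κ τ : ℝ} (hκ : 0 < κ) (hκ1 : κ ≤ 1) (hτ : 0 < τ) :
    ∃ C : ℝ, 0 < C ∧ ∀ θ, DiophantineType κ τ θ → ∀ (M : ℕ) (β : ℝ),
      |∑ n ∈ Finset.range M, sawtooth (n * θ + β)| ≤ C * (M : ℝ) ^ (τ / (1 + τ)) := by
  set a := τ / (1 + τ) with ha
  have ha0 : 0 < a := by positivity
  have hhalf : (1 / 2 : ℝ) ^ a < 1 := Real.rpow_lt_one (by norm_num) (by norm_num) ha0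
  have hden : 0 < 1 - (1 / 2 : ℝ) ^ a := by linarith
  refine ⟨3 * κ⁻¹ / (1 - (1 / 2 : ℝ) ^ a), by positivity, ?_⟩
  set C := 3 * κ⁻¹ / (1 - (1 / 2 : ℝ) ^ a) with hC
  have hCpos : 0 < C := by positivity
  have hCeq : 3 * κ⁻¹ + C * (1 / 2 : ℝ) ^ a = C := by
    have : C * (1 - (1 / 2 : ℝ) ^ a) = 3 * κ⁻¹ := by rw [hC]; field_simp
    linarith
  intro θ hθ M
  induction M using Nat.strong_induction_on with
  | _ M ih =>
  intro β
  rcases Nat.eq_zero_or_pos M with rfl | hM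
  · simp; positivity
  have hMR : (0 : ℝ) < M := by exact_mod_cast hM
  obtain ⟨x, hx, hxM⟩ := Real.exists_rat_abs_sub_le_and_den_le θ hM
  have hq : 0 < x.den := x.den_pos
  have hqR : (0 : ℝ) < x.den := by exact_mod_cast hq
  have hqM : (x.den : ℝ) ≤ M := by exact_mod_cast hxM
  rw [Rat.cast_def, le_div_iff₀ (by positivity)] at hx
  have hcop : IsCoprime x.num (x.den : ℤ) := Rat.isCoprime_num_den x
  have habs := abs_nonneg (θ - x.num / x.den)
  have hblock : |θ - x.num / x.den| * (x.den : ℝ) ^ 2 ≤ 1 := by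
    refine le_trans ?_ hx
    gcongr
    nlinarith
  have happrox : |x.den * θ - x.num| ≤ 1 / M := by
    have : x.den * θ - x.num = x.den * (θ - x.num / x.den) := by field_simp
    rw [this, abs_mul, Nat.abs_cast, le_div_iff₀ hMR]
    refine le_trans ?_ hx
    nlinarith [mul_nonneg habs hqR.le]
  have hdiv := nat_div_le_of_approx hκ hκ1 hτ hθ hM hq x.num happrox
  have hr : M % x.den < x.den := Nat.mod_lt _ hq
  have hM2 := Nat.div_add_mod M x.den
  have hk : 0 < M / x.den := Nat.div_pos hxM hq
  have hrhalf : 2 * (M % x.den) ≤ M := by nlinarith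
  have hstep := abs_sum_sawtooth_mul_add θ x.num x.den hq hcop hblock (M % x.den) _
    (ih _ (by omega)) (M / x.den) β
  rw [hM2] at hstep
  refine hstep.trans ?_
  have h1 : ((M / x.den : ℕ) : ℝ) ≤ κ⁻¹ * (M : ℝ) ^ a := Nat.cast_div_le.trans hdiv
  have h2 : ((M % x.den : ℕ) : ℝ) ^ a ≤ (1 / 2 : ℝ) ^ a * (M : ℝ) ^ a := by
    rw [← Real.mul_rpow (by norm_num) hMR.le]
    have : (2 : ℝ) * (M % x.den : ℕ) ≤ M := by exact_mod_cast hrhalf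
    apply Real.rpow_le_rpow (by positivity) (by linarith) ha0.le
  calc 3 * ((M / x.den : ℕ) : ℝ) + C * ((M % x.den : ℕ) : ℝ) ^ a
      ≤ 3 * (κ⁻¹ * (M : ℝ) ^ a) + C * ((1 / 2 : ℝ) ^ a * (M : ℝ) ^ a) := by gcongr
    _ = (3 * κ⁻¹ + C * (1 / 2 : ℝ) ^ a) * (M : ℝ) ^ a := by ring
    _ = C * (M : ℝ) ^ a := by rw [hCeq]

lemma sum_Icc_int_eq_sum_range (f : ℤ → ℝ) (A B : ℤ) :
    ∑ n ∈ Finset.Icc A B, f n = ∑ i ∈ Finset.range (B + 1 - A).toNat, f (A + i) := by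
  rw [Int.Icc_eq_finset_map, Finset.sum_map]
  rfl

lemma abs_sum_sawtooth_Icc_le {C a θ : ℝ} (hC : 0 ≤ C) (ha : 0 ≤ a)
    (hθ : ∀ (M : ℕ) (β : ℝ), |∑ n ∈ Finset.range M, sawtooth (n * θ + β)| ≤ C * (M : ℝ) ^ a)
    (A B : ℤ) (β T : ℝ) (hT : 0 ≤ T) (hAB : (B : ℝ) + 1 - A ≤ T) :
    |∑ n ∈ Finset.Icc A B, sawtooth (n * θ + β)| ≤ C * T ^ a := by
  rw [sum_Icc_int_eq_sum_range (fun n => sawtooth (n * θ + β))]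
  have e : ∀ i : ℕ, sawtooth (((A + i : ℤ) : ℝ) * θ + β) = sawtooth (i * θ + (A * θ + β)) := by
    intro i; congr 1; push_cast; ring
  simp only [e]
  refine (hθ _ _).trans ?_
  have hle : (((B + 1 - A).toNat : ℕ) : ℝ) ≤ T := by
    rcases le_total 0 (B + 1 - A) with h | h
    · have h1 : (((B + 1 - A).toNat : ℤ) : ℝ) = ((B + 1 - A : ℤ) : ℝ) := by
        rw [Int.toNat_of_nonneg h]
      rw [Int.cast_natCast] at h1
      rw [h1]
      push_cast
      exact hAB
    · rw [Int.toNat_of_nonpos h]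
      simpa using hT
  gcongr

lemma abs_sum_sawtooth_min_le {C a θ₁ θ₂ : ℝ} (hC : 0 ≤ C) (ha : 0 ≤ a) (hlt : θ₂ < θ₁)
    (h₁ : ∀ (M : ℕ) (β : ℝ), |∑ n ∈ Finset.range M, sawtooth (n * θ₁ + β)| ≤ C * (M : ℝ) ^ a)
    (h₂ : ∀ (M : ℕ) (β : ℝ), |∑ n ∈ Finset.range M, sawtooth (n * θ₂ + β)| ≤ C * (M : ℝ) ^ a)
    (A B : ℤ) (β₁ β₂ T : ℝ) (hT : 0 ≤ T) (hAB : (B : ℝ) + 1 - A ≤ T) :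
    |∑ n ∈ Finset.Icc A B, sawtooth (min (n * θ₁ + β₁) (n * θ₂ + β₂))| ≤ 2 * (C * T ^ a) := by
  set t : ℤ := ⌊(β₂ - β₁) / (θ₁ - θ₂)⌋ with ht
  have hpos : 0 < θ₁ - θ₂ := by linarith
  have hiff : ∀ n : ℤ, n ≤ t ↔ n * θ₁ + β₁ ≤ n * θ₂ + β₂ := by
    intro n
    rw [ht, Int.le_floor, le_div_iff₀ hpos]
    constructor <;> intro h <;> linarith
  have hf1 : (Finset.Icc A B).filter (fun n => n ≤ t) = Finset.Icc A (min B t) := by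
    ext n; simp only [Finset.mem_filter, Finset.mem_Icc]; omega
  have hf2 : (Finset.Icc A B).filter (fun n => ¬ n ≤ t) = Finset.Icc (max A (t + 1)) B := by
    ext n; simp only [Finset.mem_filter, Finset.mem_Icc]; omega
  rw [← Finset.sum_filter_add_sum_filter_not _ (fun n => n ≤ t)]
  have s1 : ∑ n ∈ (Finset.Icc A B).filter (fun n => n ≤ t),
      sawtooth (min (n * θ₁ + β₁) (n * θ₂ + β₂)) =
      ∑ n ∈ Finset.Icc A (min B t), sawtooth (n * θ₁ + β₁) := by
    rw [← hf1]
    refine Finset.sum_congr rfl fun n hn => ?_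
    rw [min_eq_left ((hiff n).1 (Finset.mem_filter.1 hn).2)]
  have s2 : ∑ n ∈ (Finset.Icc A B).filter (fun n => ¬ n ≤ t),
      sawtooth (min (n * θ₁ + β₁) (n * θ₂ + β₂)) =
      ∑ n ∈ Finset.Icc (max A (t + 1)) B, sawtooth (n * θ₂ + β₂) := by
    rw [← hf2]
    refine Finset.sum_congr rfl fun n hn => ?_
    rw [min_eq_right (not_le.1 (mt (hiff n).2 (Finset.mem_filter.1 hn).2)).le]
  rw [s1, s2, two_mul]
  have c1 : ((min B t : ℤ) : ℝ) ≤ B := by exact_mod_cast min_le_left _ _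
  have c2 : (A : ℝ) ≤ ((max A (t + 1) : ℤ) : ℝ) := by exact_mod_cast le_max_left _ _
  exact (abs_add_le _ _).trans (add_le_add
    (abs_sum_sawtooth_Icc_le hC ha h₁ _ _ _ _ hT (by linarith))
    (abs_sum_sawtooth_Icc_le hC ha h₂ _ _ _ _ hT (by linarith)))

lemma sum_Icc_int_sub (A B : ℤ) (h : A ≤ B + 1) (t : ℝ) :
    ∑ n ∈ Finset.Icc A B, ((n : ℝ) - t) = ((B : ℝ) - A + 1) * (((A : ℝ) + B) / 2 - t) := by
  obtain ⟨k, hk⟩ := Int.le.dest h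
  have hB : B = A + k - 1 := by omega
  subst hB
  rw [sum_Icc_int_eq_sum_range (fun n : ℤ => (n : ℝ) - t)]
  have : (A + k - 1 + 1 - A).toNat = k := by omega
  rw [this]
  clear this hk h
  push_cast
  induction k with
  | zero => simp
  | succ k ih => rw [Finset.sum_range_succ, ih]; push_cast; ring

lemma abs_sum_Icc_abs_sub_le (K : ℤ) (t : ℝ) (ht : |t| ≤ K) :
    |∑ n ∈ Finset.Icc (-K) K, |(n : ℝ) - t| - (((K : ℝ) + 1 / 2) ^ 2 + t ^ 2)| ≤ 1 / 4 := by
  obtain ⟨ht1, ht2⟩ := abs_le.1 ht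
  set m := ⌊t⌋ with hm
  have hmK : m ≤ K := by
    have : m ≤ ⌊(K : ℝ)⌋ := Int.floor_le_floor ht2
    simpa using this
  have hKm : -K ≤ m := by
    rw [hm, Int.le_floor]; push_cast; linarith
  have hf1 : (Finset.Icc (-K) K).filter (fun n => n ≤ m) = Finset.Icc (-K) m := by
    ext n; simp only [Finset.mem_filter, Finset.mem_Icc]; omega
  have hf2 : (Finset.Icc (-K) K).filter (fun n => ¬ n ≤ m) = Finset.Icc (m + 1) K := by
    ext n; simp only [Finset.mem_filter, Finset.mem_Icc]; omega
  have hm1 : (m : ℝ) ≤ t := Int.floor_le t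
  have hm2 : t < m + 1 := Int.lt_floor_add_one t
  rw [← Finset.sum_filter_add_sum_filter_not _ (fun n => n ≤ m), hf1, hf2]
  have s1 : ∑ n ∈ Finset.Icc (-K) m, |(n : ℝ) - t| = -∑ n ∈ Finset.Icc (-K) m, ((n : ℝ) - t) := by
    rw [← Finset.sum_neg_distrib]
    refine Finset.sum_congr rfl fun n hn => abs_of_nonpos ?_
    have : (n : ℝ) ≤ m := by exact_mod_cast (Finset.mem_Icc.1 hn).2
    linarith
  have s2 : ∑ n ∈ Finset.Icc (m + 1) K, |(n : ℝ) - t| =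
      ∑ n ∈ Finset.Icc (m + 1) K, ((n : ℝ) - t) := by
    refine Finset.sum_congr rfl fun n hn => abs_of_nonneg ?_
    have : ((m + 1 : ℤ) : ℝ) ≤ n := by exact_mod_cast (Finset.mem_Icc.1 hn).1
    push_cast at this
    linarith
  rw [s1, s2, sum_Icc_int_sub _ _ (by omega), sum_Icc_int_sub _ _ (by omega)]
  push_cast
  set r := t - m with hr
  have hr0 : 0 ≤ r := by linarith
  have hr1 : r ≤ 1 := by linarith
  have ht' : t = m + r := by linarith
  rw [ht', abs_le]
  constructor <;> nlinarith [sq_nonneg (r - 1 / 2), mul_nonneg hr0 (sub_nonneg.2 hr1)]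

lemma trapezoid_eq (A B X : ℝ) (hA : 0 ≤ A) (hB : 0 ≤ B) :
    max 0 (min (min A B) (min X (A + B - X))) =
      (|X| - |X - A| - |X - B| + |X - (A + B)|) / 2 := by
  rcases le_total 0 X with h1 | h1 <;> rcases le_total X A with h2 | h2 <;>
    rcases le_total X B with h3 | h3 <;> rcases le_total X (A + B) with h4 | h4 <;>
    rcases le_total A B with h5 | h5 <;>
    grind

lemma abs_sum_trapezoid_sub_le (A B x₀ : ℝ) (K : ℤ) (hA : 0 ≤ A) (hB : 0 ≤ B)
    (h₀ : |x₀| + A + B ≤ K) :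
    |∑ n ∈ Finset.Icc (-K) K,
      max 0 (min (min A B) (min ((n : ℝ) - x₀) (A + B - ((n : ℝ) - x₀)))) - A * B| ≤ 1 / 2 := by
  obtain ⟨hx1, hx2⟩ := abs_le.1 (le_refl |x₀|)
  have e1 := abs_sum_Icc_abs_sub_le K x₀ (by rw [abs_le]; constructor <;> linarith)
  have e2 := abs_sum_Icc_abs_sub_le K (x₀ + A) (by rw [abs_le]; constructor <;> linarith)
  have e3 := abs_sum_Icc_abs_sub_le K (x₀ + B) (by rw [abs_le]; constructor <;> linarith)
  have e4 := abs_sum_Icc_abs_sub_le K (x₀ + (A + B)) (by rw [abs_le]; constructor <;> linarith)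
  simp_rw [trapezoid_eq _ _ _ hA hB, sub_sub, ← Finset.sum_div, Finset.sum_add_distrib,
    Finset.sum_sub_distrib, Finset.sum_add_distrib]
  rw [abs_le] at *
  constructor <;> nlinarith

/-- A quantitative lower bound for the distance from lattice points to the line spanned by
`(c, s)`. -/
def VectorDiophantine (κ τ c s : ℝ) : Prop :=
  ∀ p q : ℤ, p ≠ 0 ∨ q ≠ 0 → ∀ T : ℝ, |(p : ℝ)| ≤ T → |(q : ℝ)| ≤ T →
    κ * T ^ (-(1 + τ)) ≤ |q * s - p * c|

lemma VectorDiophantine.rotate {κ τ c s : ℝ} (h : VectorDiophantine κ τ c s) :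
    VectorDiophantine κ τ (-s) c := by
  intro p q hpq T hp hq
  have := h q (-p) (by simpa [or_comm] using hpq) T hq (by simpa using hp)
  rw [← abs_neg]
  convert this using 2
  push_cast
  ring

lemma VectorDiophantine.reflect {κ τ c s : ℝ} (h : VectorDiophantine κ τ c s) :
    VectorDiophantine κ τ c (-s) := by
  intro p q hpq T hp hq
  have := h p (-q) (by simpa using hpq) T hp (by simpa using hq)
  convert this using 2
  push_cast
  ring

lemma VectorDiophantine.le_fst {κ τ c s : ℝ} (h : VectorDiophantine κ τ c s) : κ ≤ |c| := by
  have := h 1 0 (by simp) 1 (by simp) (by simp)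
  simpa using this

lemma VectorDiophantine.le_snd {κ τ c s : ℝ} (h : VectorDiophantine κ τ c s) : κ ≤ |s| := by
  have := h 0 1 (by simp) 1 (by simp) (by simp)
  simpa using this

lemma VectorDiophantine.diophantineType {κ τ c s : ℝ} (hκ : 0 < κ) (hκ1 : κ ≤ 1) (hτ : 0 < τ)
    (hc : 0 < c) (hc1 : c ≤ 1) (hs1 : |s| ≤ 1) (h : VectorDiophantine κ τ c s) :
    DiophantineType (κ * (1 / κ + 1) ^ (-(1 + τ))) τ (s / c) := by
  intro p q hq
  have hqR : (1 : ℝ) ≤ q := by exact_mod_cast hq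
  set L := 1 / κ + 1 with hL
  have hL1 : 1 ≤ L := by rw [hL]; have := one_div_pos.2 hκ; linarith
  have hκc : κ ≤ c := by simpa [abs_of_pos hc] using h.le_fst
  have hθ : |s / c| ≤ 1 / κ := by
    rw [abs_div, abs_of_pos hc]
    gcongr
  rw [mul_assoc, ← Real.mul_rpow (by positivity) (by positivity)]
  rcases le_total 1 |q * (s / c) - p| with h1 | h1
  · refine le_trans ?_ h1
    have hLq : 1 ≤ L * q := by nlinarith
    have : (L * q) ^ (-(1 + τ)) ≤ 1 := Real.rpow_le_one_of_one_le_of_nonpos hLq (by linarith)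
    nlinarith [Real.rpow_nonneg (show 0 ≤ L * q by positivity) (-(1 + τ))]
  · have hp : |(p : ℝ)| ≤ L * q := by
      have h2 : |(p : ℝ)| ≤ |q * (s / c)| + |q * (s / c) - p| := by
        have := abs_sub (q * (s / c)) (q * (s / c) - p)
        simpa using this
      rw [abs_mul, Nat.abs_cast] at h2
      have : (q : ℝ) * |s / c| ≤ q * (1 / κ) := by gcongr
      rw [hL]
      linarith
    have h3 := h p q (Or.inr (by exact_mod_cast hq.ne')) (L * q) hp
      (by rw [Int.cast_natCast, Nat.abs_cast]; nlinarith)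
    refine h3.trans ?_
    have e : q * (s / c) - p = (q * s - p * c) / c := by field_simp
    rw [e, abs_div, abs_of_pos hc, le_div_iff₀ hc, Int.cast_natCast]
    exact mul_le_of_le_one_right (abs_nonneg _) hc1

/-- The integer points of the rectangle with sides in the directions `(c, s)` and `(-s, c)`. -/
def latticeRect (c s a b w h : ℝ) : Set (ℤ × ℤ) :=
  {z | (a ≤ c * z.1 + s * z.2 ∧ c * z.1 + s * z.2 ≤ a + w) ∧
    (b ≤ -s * z.1 + c * z.2 ∧ -s * z.1 + c * z.2 ≤ b + h)}

lemma min_add_min_sides_eq {c s : ℝ} (hc : 0 < c) (hs : 0 < s) (hcs : c ^ 2 + s ^ 2 = 1)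
    (a b w h x : ℝ) :
    min (x * (s / c) + (b + h) / c) (x * (-(c / s)) + (a + w) / s) +
      min (x * (c / s) + (-a / s)) (x * (-(s / c)) + (-b / c)) =
    1 / (c * s) * min (min (w * c) (h * s)) (min (x - (c * a - s * b - h * s))
      (w * c + h * s - (x - (c * a - s * b - h * s)))) := by
  have hpos : 0 ≤ 1 / (c * s) := by positivity
  rw [mul_min_of_nonneg _ _ hpos, mul_min_of_nonneg _ _ hpos, mul_min_of_nonneg _ _ hpos]
  have f1 : 1 / (c * s) * (w * c) =
      (x * (-(c / s)) + (a + w) / s) + (x * (c / s) + (-a / s)) := by field_simp; ring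
  have f2 : 1 / (c * s) * (h * s) =
      (x * (s / c) + (b + h) / c) + (x * (-(s / c)) + (-b / c)) := by field_simp; ring
  have f3 : 1 / (c * s) * (x - (c * a - s * b - h * s)) =
      (x * (s / c) + (b + h) / c) + (x * (c / s) + (-a / s)) := by
    field_simp
    linear_combination (-x) * hcs
  have f4 : 1 / (c * s) * (w * c + h * s - (x - (c * a - s * b - h * s))) =
      (x * (-(c / s)) + (a + w) / s) + (x * (-(s / c)) + (-b / c)) := by
    field_simp
    linear_combination x * hcs
  rw [f1, f2, f3, f4]
  generalize x * (s / c) + (b + h) / c = u₁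
  generalize x * (-(c / s)) + (a + w) / s = u₂
  generalize x * (c / s) + -a / s = l₁
  generalize x * (-(s / c)) + -b / c = l₂
  rw [min_add, add_min, add_min]
  grind

lemma latticeRect_finite_and_ncard {c s : ℝ} (hc : 0 < c) (hs : 0 < s) (hcs : c ^ 2 + s ^ 2 = 1)
    (a b w h : ℝ) {u l : ℝ → ℝ}
    (hu : ∀ x, u x = min (x * (s / c) + (b + h) / c) (x * (-(c / s)) + (a + w) / s))
    (hl : ∀ x, l x = min (x * (c / s) + (-a / s)) (x * (-(s / c)) + (-b / c)))
    (hw : 0 ≤ w) (hh : 0 ≤ h) :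
    (latticeRect c s a b w h).Finite ∧ ((latticeRect c s a b w h).ncard : ℝ) =
      ∑ n ∈ Finset.Icc ⌈c * a - s * b - h * s⌉ ⌊c * a - s * b - h * s + (w * c + h * s)⌋,
        (sawtooth (u n) + sawtooth (l n) + (u n + l n)) := by
  set x₀ := c * a - s * b - h * s with hx₀
  set I := Finset.Icc ⌈x₀⌉ ⌊x₀ + (w * c + h * s)⌋ with hI
  have hid : ∀ x, u x + l x = 1 / (c * s) * min (min (w * c) (h * s)) (min (x - x₀)
      (w * c + h * s - (x - x₀))) := fun x => by
    rw [hu, hl]; exact min_add_min_sides_eq hc hs hcs a b w h x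
  have hpos : 0 < 1 / (c * s) := by positivity
  have hset : latticeRect c s a b w h =
      ((I.sigma fun n => Finset.Icc (-⌊l n⌋) ⌊u n⌋).image fun z => (z.1, z.2) : Finset (ℤ × ℤ)) := by
    ext ⟨n, m⟩
    have hu' : m ≤ ⌊u n⌋ ↔ -s * n + c * m ≤ b + h ∧ c * n + s * m ≤ a + w := by
      rw [Int.le_floor, hu, le_min_iff]
      have e1 : (n : ℝ) * (s / c) + (b + h) / c = (n * s + (b + h)) / c := by ring
      have e2 : (n : ℝ) * (-(c / s)) + (a + w) / s = (-(n * c) + (a + w)) / s := by ring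
      rw [e1, e2, le_div_iff₀ hc, le_div_iff₀ hs]
      constructor <;> rintro ⟨h1, h2⟩ <;> constructor <;> linarith
    have hl' : -⌊l n⌋ ≤ m ↔ a ≤ c * n + s * m ∧ b ≤ -s * n + c * m := by
      rw [neg_le, Int.le_floor, hl, le_min_iff]
      have e1 : (n : ℝ) * (c / s) + -a / s = (n * c - a) / s := by ring
      have e2 : (n : ℝ) * (-(s / c)) + -b / c = (-(n * s) - b) / c := by ring
      rw [e1, e2, le_div_iff₀ hs, le_div_iff₀ hc]
      push_cast
      constructor <;> rintro ⟨h1, h2⟩ <;> constructor <;> linarith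
    simp only [latticeRect, Set.mem_ofPred_eq, Finset.coe_image, Set.mem_image, Finset.mem_coe,
      Finset.mem_sigma, Finset.mem_Icc, Prod.mk.injEq, Sigma.exists, hI]
    constructor
    · rintro ⟨⟨h1, h2⟩, h3, h4⟩
      have hlm := hl'.2 ⟨h1, h3⟩
      have hum := hu'.2 ⟨h4, h2⟩
      have hn : (n : ℝ) = c * (c * n + s * m) - s * (-s * n + c * m) := by
        linear_combination -(n : ℝ) * hcs
      refine ⟨n, m, ⟨⟨?_, ?_⟩, hlm, hum⟩, rfl, rfl⟩
      · rw [Int.ceil_le, hx₀, hn]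
        linarith [mul_le_mul_of_nonneg_left h1 hc.le, mul_le_mul_of_nonneg_left h4 hs.le]
      · rw [Int.le_floor, hx₀, hn]
        linarith [mul_le_mul_of_nonneg_left h2 hc.le, mul_le_mul_of_nonneg_left h3 hs.le]
    · rintro ⟨n', m', ⟨-, h1, h2⟩, rfl, rfl⟩
      exact ⟨⟨(hl'.1 h1).1, (hu'.1 h2).2⟩, (hl'.1 h1).2, (hu'.1 h2).1⟩
  refine ⟨hset ▸ Finset.finite_toSet _, ?_⟩
  rw [hset, Set.ncard_coe_finset, Finset.card_image_of_injective, Finset.card_sigma]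
  · push_cast
    refine Finset.sum_congr rfl fun n hn => ?_
    rw [hI, Finset.mem_Icc, Int.ceil_le, Int.le_floor] at hn
    have hnn : 0 ≤ u n + l n := by
      rw [hid]
      refine mul_nonneg hpos.le (le_min (le_min (by positivity) (by positivity))
        (le_min ?_ ?_)) <;> linarith
    have h0 : 0 ≤ ⌊u n⌋ + 1 - -⌊l n⌋ := by
      have h1 := Int.lt_floor_add_one (u n)
      have h2 := Int.lt_floor_add_one (l n)
      have h3 : (0 : ℝ) < ((⌊u n⌋ + 1 + (⌊l n⌋ + 1) : ℤ) : ℝ) := by push_cast; linarith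
      have h4 : 0 < ⌊u n⌋ + 1 + (⌊l n⌋ + 1) := by exact_mod_cast h3
      omega
    rw [Int.card_Icc]
    have h5 : (((⌊u n⌋ + 1 - -⌊l n⌋).toNat : ℤ) : ℝ) = ((⌊u n⌋ + 1 - -⌊l n⌋ : ℤ) : ℝ) := by
      rw [Int.toNat_of_nonneg h0]
    rw [Int.cast_natCast] at h5
    rw [h5]
    unfold sawtooth
    push_cast
    ring
  · rintro ⟨n, m⟩ ⟨n', m'⟩ h
    simpa using h

lemma exists_abs_ncard_latticeRect_sub_le_of_pos {κ τ : ℝ} (hκ : 0 < κ) (hκ1 : κ ≤ 1)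
    (hτ : 0 < τ) :
    ∃ C : ℝ, 0 < C ∧ ∀ c s : ℝ, 0 < c → 0 < s → c ^ 2 + s ^ 2 = 1 → VectorDiophantine κ τ c s →
      ∀ a b w h T : ℝ, 0 ≤ w → 0 ≤ h → w ≤ T → h ≤ T → 1 ≤ T →
        (latticeRect c s a b w h).Finite ∧
        |((latticeRect c s a b w h).ncard : ℝ) - w * h| ≤ C * T ^ (τ / (1 + τ)) := by
  have hL : (1 : ℝ) ≤ 1 / κ + 1 := by have := one_div_pos.2 hκ; linarith
  have hpow : (1 / κ + 1) ^ (-(1 + τ)) ≤ 1 :=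
    Real.rpow_le_one_of_one_le_of_nonpos hL (by linarith)
  have hpow0 : 0 < (1 / κ + 1) ^ (-(1 + τ)) := by positivity
  obtain ⟨C₁, hC₁, hsum⟩ := exists_abs_sum_sawtooth_le
    (κ := κ * (1 / κ + 1) ^ (-(1 + τ))) (by positivity) (by nlinarith) hτ
  set e := τ / (1 + τ) with he
  have he0 : 0 ≤ e := by positivity
  refine ⟨4 * C₁ * 3 ^ e + 1 / κ ^ 2, by positivity, ?_⟩
  intro c s hc hs hcs hD a b w h T hw hh hwT hhT hT
  have hc1 : c ≤ 1 := by nlinarith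
  have hs1 : s ≤ 1 := by nlinarith
  have hκc : κ ≤ c := by simpa [abs_of_pos hc] using hD.le_fst
  have hκs : κ ≤ s := by simpa [abs_of_pos hs] using hD.le_snd
  have habs : ∀ {x : ℝ}, 0 < x → x ≤ 1 → |x| ≤ 1 := fun h0 h1 => by rwa [abs_of_pos h0]
  have habs' : ∀ {x : ℝ}, 0 < x → x ≤ 1 → |-x| ≤ 1 := fun h0 h1 => by
    rwa [abs_neg, abs_of_pos h0]
  have d1 := hsum _ (hD.diophantineType hκ hκ1 hτ hc hc1 (habs hs hs1))
  have d2 := hsum _ (hD.reflect.diophantineType hκ hκ1 hτ hc hc1 (habs' hs hs1))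
  have hD' : VectorDiophantine κ τ s c := by simpa using hD.reflect.rotate
  have d3 := hsum _ (hD'.diophantineType hκ hκ1 hτ hs hs1 (habs hc hc1))
  have d4 := hsum _ (hD'.reflect.diophantineType hκ hκ1 hτ hs hs1 (habs' hc hc1))
  rw [neg_div] at d2 d4
  obtain ⟨hfin, hcard⟩ := latticeRect_finite_and_ncard hc hs hcs a b w h
    (fun _ => rfl) (fun _ => rfl) hw hh
  refine ⟨hfin, ?_⟩
  rw [hcard, Finset.sum_add_distrib, Finset.sum_add_distrib]
  have hsc : 0 < s / c := by positivity
  have hcs' : 0 < c / s := by positivity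
  set x₀ := c * a - s * b - h * s with hx₀
  have hlen : ((⌊x₀ + (w * c + h * s)⌋ : ℤ) : ℝ) + 1 - (⌈x₀⌉ : ℤ) ≤ 3 * T := by
    have h1 := Int.floor_le (x₀ + (w * c + h * s))
    have h2 := Int.le_ceil x₀
    nlinarith
  have b1 := abs_sum_sawtooth_min_le hC₁.le he0 (by linarith) d1 d4
    ⌈x₀⌉ ⌊x₀ + (w * c + h * s)⌋ ((b + h) / c) ((a + w) / s) (3 * T) (by positivity) hlen
  have b2 := abs_sum_sawtooth_min_le hC₁.le he0 (by linarith) d3 d2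
    ⌈x₀⌉ ⌊x₀ + (w * c + h * s)⌋ (-a / s) (-b / c) (3 * T) (by positivity) hlen
  have b3 : |∑ n ∈ Finset.Icc ⌈x₀⌉ ⌊x₀ + (w * c + h * s)⌋,
      (min ((n : ℝ) * (s / c) + (b + h) / c) (n * (-(c / s)) + (a + w) / s) +
        min (n * (c / s) + (-a / s)) (n * (-(s / c)) + (-b / c))) - w * h| ≤ 1 / κ ^ 2 := by
    set A := w * c with hA
    set B := h * s with hB
    have hA0 : 0 ≤ A := by positivity
    have hB0 : 0 ≤ B := by positivity
    set K := ⌈|x₀| + A + B⌉ with hK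
    have hK' : |x₀| + A + B ≤ K := Int.le_ceil _
    have ht := abs_sum_trapezoid_sub_le A B x₀ K hA0 hB0 hK'
    obtain ⟨hx1, hx2⟩ := abs_le.1 (le_refl |x₀|)
    have hsub : Finset.Icc ⌈x₀⌉ ⌊x₀ + (A + B)⌋ ⊆ Finset.Icc (-K) K := by
      intro n hn
      rw [Finset.mem_Icc, Int.ceil_le, Int.le_floor] at hn
      rw [Finset.mem_Icc]
      constructor
      · have : ((-K : ℤ) : ℝ) ≤ n := by push_cast; linarith
        exact_mod_cast this
      · have : (n : ℝ) ≤ K := by linarith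
        exact_mod_cast this
    have hsumeq : ∑ n ∈ Finset.Icc ⌈x₀⌉ ⌊x₀ + (A + B)⌋,
        (min ((n : ℝ) * (s / c) + (b + h) / c) (n * (-(c / s)) + (a + w) / s) +
          min (n * (c / s) + (-a / s)) (n * (-(s / c)) + (-b / c))) =
        1 / (c * s) * ∑ n ∈ Finset.Icc (-K) K,
          max 0 (min (min A B) (min ((n : ℝ) - x₀) (A + B - ((n : ℝ) - x₀)))) := by
      rw [← Finset.sum_subset hsub, Finset.mul_sum]
      · refine Finset.sum_congr rfl fun n hn => ?_
        rw [Finset.mem_Icc, Int.ceil_le, Int.le_floor] at hn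
        rw [min_add_min_sides_eq hc hs hcs, max_eq_right]
        refine le_min (le_min hA0 hB0) (le_min ?_ ?_) <;> linarith
      · intro n _ hn
        rw [Finset.mem_Icc, Int.ceil_le, Int.le_floor, not_and_or, not_le, not_le] at hn
        refine max_eq_left ((min_le_right _ _).trans ?_)
        rcases hn with hn | hn
        · exact (min_le_left _ _).trans (by linarith)
        · exact (min_le_right _ _).trans (by linarith)
    have hwh : w * h = 1 / (c * s) * (A * B) := by rw [hA, hB]; field_simp
    rw [hsumeq, hwh, ← mul_sub, abs_mul, abs_of_pos (by positivity)]
    have hcsκ : 1 / (c * s) ≤ 1 / κ ^ 2 := by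
      rw [sq]; gcongr
    calc 1 / (c * s) * _ ≤ 1 / κ ^ 2 * (1 / 2) := by gcongr
      _ ≤ 1 / κ ^ 2 := by have : 0 < 1 / κ ^ 2 := by positivity
                          linarith
  have hTe : 1 ≤ T ^ e := Real.one_le_rpow hT he0
  rw [Real.mul_rpow (by norm_num) (by linarith)] at b1 b2
  have hκT : 1 / κ ^ 2 ≤ 1 / κ ^ 2 * T ^ e := le_mul_of_one_le_right (by positivity) hTe
  rw [abs_le] at b1 b2 b3 ⊢
  constructor <;> linarith [b1.1, b1.2, b2.1, b2.2, b3.1, b3.2]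

lemma latticeRect_rotate (c s a b w h : ℝ) :
    latticeRect c s a b w h = latticeRect (-s) c b (-a - w) h w := by
  ext z
  simp only [latticeRect, Set.mem_ofPred_eq]
  constructor <;> rintro ⟨⟨h1, h2⟩, h3, h4⟩ <;> refine ⟨⟨?_, ?_⟩, ?_, ?_⟩ <;> linarith

lemma exists_abs_ncard_latticeRect_sub_le {κ τ : ℝ} (hκ : 0 < κ) (hκ1 : κ ≤ 1) (hτ : 0 < τ) :
    ∃ C : ℝ, 0 < C ∧ ∀ c s : ℝ, 0 < c → c ^ 2 + s ^ 2 = 1 → VectorDiophantine κ τ c s →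
      ∀ a b w h T : ℝ, 0 ≤ w → 0 ≤ h → w ≤ T → h ≤ T → 1 ≤ T →
        (latticeRect c s a b w h).Finite ∧
        |((latticeRect c s a b w h).ncard : ℝ) - w * h| ≤ C * T ^ (τ / (1 + τ)) := by
  obtain ⟨C, hC, H⟩ := exists_abs_ncard_latticeRect_sub_le_of_pos hκ hκ1 hτ
  refine ⟨C, hC, fun c s hc hcs hD a b w h T hw hh hwT hhT hT => ?_⟩
  rcases lt_trichotomy s 0 with hs | rfl | hs
  · rw [latticeRect_rotate, mul_comm w h]
    exact H (-s) c (by linarith) hc (by linarith) hD.rotate _ _ _ _ T hh hw hhT hwT hT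
  · have := hD.le_snd
    simp at this
    linarith
  · exact H c s hc hs hcs hD _ _ _ _ T hw hh hwT hhT hT


lemma exists_int_abs_sub_mul_pi_le {x : ℝ} (h1 : -(3 * Real.pi / 2) ≤ x)
    (h2 : x ≤ 3 * Real.pi / 2) :
    ∃ j ∈ Finset.Icc (-1 : ℤ) 1, |x - j * Real.pi| ≤ 2 * |Real.sin x| := by
  have hpi := Real.pi_pos
  have key : ∀ u : ℝ, |u| ≤ Real.pi / 2 → |u| ≤ 2 * |Real.sin u| := by
    intro u hu
    have h := Real.mul_abs_le_abs_sin hu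
    rw [div_mul_eq_mul_div, div_le_iff₀ hpi] at h
    have := abs_nonneg (Real.sin u)
    nlinarith [Real.pi_le_four]
  rcases lt_or_ge x (-(Real.pi / 2)) with h | h
  · refine ⟨-1, by simp, ?_⟩
    have := key (x + Real.pi) (by rw [abs_le]; constructor <;> linarith)
    rw [Real.sin_add_pi, abs_neg] at this
    simpa using this
  rcases le_or_gt x (Real.pi / 2) with h' | h'
  · refine ⟨0, by simp, ?_⟩
    simpa using key x (by rw [abs_le]; constructor <;> linarith)
  · refine ⟨1, by simp, ?_⟩
    have := key (x - Real.pi) (by rw [abs_le]; constructor <;> linarith)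
    rw [Real.sin_sub_pi, abs_neg] at this
    simpa using this

lemma one_le_norm_int_vector {v : Fin 2 → ℤ} (hv : v ≠ 0) : 1 ≤ ‖v‖ := by
  obtain ⟨i, hi⟩ := Function.ne_iff.1 hv
  refine le_trans ?_ (norm_le_pi_norm v i)
  rw [Int.norm_eq_abs]
  exact_mod_cast Int.one_le_abs hi

/-- If `α` avoids small intervals around the angles of lattice points relative to `φ`, the
direction `φ - α` is far from every lattice point. -/
lemma vectorDiophantine_of_avoid {κ τ α φ : ℝ} (hκ : 0 < κ) (hτ : 0 < τ)
    (hα : α ∈ Set.Ioo 0 (Real.pi / 2)) (hφ : φ ∈ Set.Ico 0 (Real.pi / 2))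
    (h : ∀ v : Fin 2 → ℤ, v ≠ 0 → ∀ j ∈ Finset.Icc (-1 : ℤ) 1,
      2 * (κ * ‖v‖ ^ (-(2 + τ))) <
        |φ - α - Complex.arg ⟨v 1, v 0⟩ - j * Real.pi|) :
    VectorDiophantine κ τ (Real.cos (φ - α)) (Real.sin (φ - α)) := by
  intro p q hpq T hp hq
  set v : Fin 2 → ℤ := ![p, q] with hv
  have hv0 : v ≠ 0 := by
    intro h0
    have e0 : v 0 = 0 := by rw [h0]; rfl
    have e1 : v 1 = 0 := by rw [h0]; rfl
    simp only [hv, Matrix.cons_val_zero, Matrix.cons_val_one] at e0 e1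
    tauto
  have hnv := one_le_norm_int_vector hv0
  have hnv0 : 0 < ‖v‖ := by linarith
  have hvT : ‖v‖ ≤ T := by
    rw [pi_norm_le_iff_of_nonneg ((abs_nonneg _).trans hp)]
    intro i
    fin_cases i
    · simpa [hv, Int.norm_eq_abs] using hp
    · simpa [hv, Int.norm_eq_abs] using hq
  have hmono : κ * T ^ (-(1 + τ)) ≤ κ * ‖v‖ ^ (-(1 + τ)) := by
    gcongr ?_ * ?_
    exact Real.rpow_le_rpow_of_nonpos hnv0 hvT (by linarith)
  refine hmono.trans ?_
  by_contra! hlt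
  set z : ℂ := ⟨v 1, v 0⟩ with hz
  have hq' : (q : ℝ) = ‖z‖ * Real.cos z.arg := by rw [Complex.norm_mul_cos_arg]; simp [hz, hv]
  have hp' : (p : ℝ) = ‖z‖ * Real.sin z.arg := by rw [Complex.norm_mul_sin_arg]; simp [hz, hv]
  have hvz : ‖v‖ ≤ ‖z‖ := by
    rw [pi_norm_le_iff_of_nonneg (norm_nonneg _)]
    intro i
    fin_cases i
    · simpa [hz, Int.norm_eq_abs] using Complex.abs_im_le_norm z
    · simpa [hz, Int.norm_eq_abs] using Complex.abs_re_le_norm z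
  have hsin : q * Real.sin (φ - α) - p * Real.cos (φ - α) =
      ‖z‖ * Real.sin (φ - α - z.arg) := by
    rw [Real.sin_sub (φ - α), hq', hp']; ring
  rw [hsin, abs_mul, abs_norm] at hlt
  have hsmall : |Real.sin (φ - α - z.arg)| < κ * ‖v‖ ^ (-(2 + τ)) := by
    have e : κ * ‖v‖ ^ (-(1 + τ)) = ‖v‖ * (κ * ‖v‖ ^ (-(2 + τ))) := by
      have : -(1 + τ) = 1 + -(2 + τ) := by ring
      rw [this, Real.rpow_add hnv0, Real.rpow_one]; ring
    rw [e] at hlt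
    refine lt_of_mul_lt_mul_left (lt_of_le_of_lt ?_ hlt) hnv0.le
    gcongr
  obtain ⟨j, hj, hj'⟩ := exists_int_abs_sub_mul_pi_le (x := φ - α - z.arg)
    (by linarith [hα.1, hα.2, hφ.1, hφ.2, Complex.arg_le_pi z, Complex.neg_pi_lt_arg z])
    (by linarith [hα.1, hα.2, hφ.1, hφ.2, Complex.arg_le_pi z, Complex.neg_pi_lt_arg z])
  linarith [h v hv0 j hj]

lemma exists_small_scale (B t : ℝ) (hB : 0 ≤ B) (ht : 0 < t) :
    ∃ κ : ℝ, 0 < κ ∧ κ < 1 ∧ B * κ ^ t < Real.pi / 2 := by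
  have hbase : 0 < 1 / (B + 2) := by positivity
  have hbase1 : 1 / (B + 2) < 1 := by rw [div_lt_one (by positivity)]; linarith
  refine ⟨(1 / (B + 2)) ^ (1 / t), by positivity,
    Real.rpow_lt_one hbase.le hbase1 (by positivity), ?_⟩
  rw [← Real.rpow_mul hbase.le, one_div_mul_cancel ht.ne', Real.rpow_one, mul_one_div]
  have : B / (B + 2) < 1 := by rw [div_lt_one (by positivity)]; linarith
  linarith [Real.pi_gt_three]

lemma exists_vectorDiophantine_rotation {Ω : Set ℝ} (hΩ : Ω ⊆ Set.Ico 0 (Real.pi / 2))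
    {s τ D : ℝ} (hs1 : s < 1) (hτ : 0 < τ) (hst : 2 < (2 + τ) * (1 - s)) (hD : 0 ≤ D)
    (hcover : ∀ δ : ℝ, 0 < δ → δ < 1 → ∃ F : Finset ℝ, (F.card : ℝ) ≤ D * δ ^ (-s) ∧
      Ω ⊆ ⋃ x ∈ F, Set.Icc x (x + δ)) :
    ∃ κ : ℝ, 0 < κ ∧ κ ≤ 1 ∧ ∃ α ∈ Set.Ioo 0 (Real.pi / 2), ∀ φ ∈ Ω,
      VectorDiophantine κ τ (Real.cos (φ - α)) (Real.sin (φ - α)) := by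
  set k := (2 + τ) * (1 - s) with hk
  have hsummable := EisensteinSeries.summable_one_div_norm_rpow hst
  set Z := ∑' v : Fin 2 → ℤ, ‖v‖ ^ (-k) with hZ
  have hZ0 : 0 ≤ Z := tsum_nonneg fun v => by positivity
  obtain ⟨κ, hκ, hκ1, hκB⟩ := exists_small_scale (15 * D * Z) (1 - s) (by positivity) (by linarith)
  refine ⟨κ, hκ, hκ1.le, ?_⟩
  set δ : (Fin 2 → ℤ) → ℝ := fun v => κ * ‖v‖ ^ (-(2 + τ)) with hδ
  have hF : ∀ v : Fin 2 → ℤ, ∃ F : Finset ℝ,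
      (F.card : ℝ) * δ v ≤ D * κ ^ (1 - s) * ‖v‖ ^ (-k) ∧
      (v ≠ 0 → Ω ⊆ ⋃ x ∈ F, Set.Icc x (x + δ v)) := by
    intro v
    rcases eq_or_ne v 0 with rfl | hv
    · exact ⟨∅, by simp only [Finset.card_empty, Nat.cast_zero, zero_mul]; positivity, by simp⟩
    have hnv := one_le_norm_int_vector hv
    have hnv0 : 0 < ‖v‖ := by linarith
    have hδ0 : 0 < δ v := by positivity
    have hδ1 : δ v < 1 := by
      have : ‖v‖ ^ (-(2 + τ)) ≤ 1 := Real.rpow_le_one_of_one_le_of_nonpos hnv (by linarith)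
      have h0 : 0 < ‖v‖ ^ (-(2 + τ)) := by positivity
      simp only [hδ]
      nlinarith
    obtain ⟨F, hcard, hsub⟩ := hcover (δ v) hδ0 hδ1
    refine ⟨F, ?_, fun _ => hsub⟩
    have e : δ v ^ (-s) * δ v = κ ^ (1 - s) * ‖v‖ ^ (-k) := by
      have h1 : δ v ^ (-s) * δ v = δ v ^ (1 - s) := by
        conv_lhs => rw [← Real.rpow_one (δ v), ← Real.rpow_mul hδ0.le, ← Real.rpow_add hδ0]
        congr 1; ring
      rw [h1]
      simp only [hδ]
      rw [Real.mul_rpow hκ.le (by positivity), ← Real.rpow_mul hnv0.le, hk]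
      congr 2; ring
    calc (F.card : ℝ) * δ v ≤ D * δ v ^ (-s) * δ v := by gcongr
      _ = D * κ ^ (1 - s) * ‖v‖ ^ (-k) := by rw [mul_assoc, e, mul_assoc]
  choose F hFcard hFsub using hF
  set bad : (Fin 2 → ℤ) → Set ℝ := fun v => ⋃ j ∈ Finset.Icc (-1 : ℤ) 1, ⋃ x ∈ F v,
    Set.Icc (x - Complex.arg ⟨v 1, v 0⟩ - j * Real.pi - 2 * δ v)
      (x - Complex.arg ⟨v 1, v 0⟩ - j * Real.pi + 3 * δ v) with hbad
  have hδnn : ∀ v, 0 ≤ δ v := fun v => by positivity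
  have hvol : ∀ v, volume (bad v) ≤ ENNReal.ofReal (15 * D * κ ^ (1 - s) * ‖v‖ ^ (-k)) := by
    intro v
    calc volume (bad v) ≤ ∑ j ∈ Finset.Icc (-1 : ℤ) 1, ∑ x ∈ F v, ENNReal.ofReal (5 * δ v) := by
          refine (measure_biUnion_finset_le _ _).trans (Finset.sum_le_sum fun j _ => ?_)
          refine (measure_biUnion_finset_le _ _).trans (Finset.sum_le_sum fun x _ => ?_)
          rw [Real.volume_Icc]
          apply ENNReal.ofReal_le_ofReal
          linarith
      _ = ENNReal.ofReal (15 * ((F v).card * δ v)) := by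
          have h3 : (Finset.Icc (-1 : ℤ) 1).card = 3 := by simp
          rw [Finset.sum_const, Finset.sum_const, h3, ← ENNReal.ofReal_nsmul,
            ← ENNReal.ofReal_nsmul]
          congr 1
          simp only [nsmul_eq_mul]
          push_cast
          ring
      _ ≤ _ := by
          apply ENNReal.ofReal_le_ofReal
          linarith [hFcard v]
  have hex : ∃ α ∈ Set.Ioo 0 (Real.pi / 2), α ∉ ⋃ v, bad v := by
    by_contra! hcon
    have h1 : volume (Set.Ioo 0 (Real.pi / 2)) ≤ volume (⋃ v, bad v) := measure_mono hcon
    have h2 : volume (⋃ v, bad v) ≤ ENNReal.ofReal (15 * D * Z * κ ^ (1 - s)) := by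
      refine (measure_iUnion_le _).trans ((ENNReal.tsum_le_tsum hvol).trans ?_)
      rw [← ENNReal.ofReal_tsum_of_nonneg (fun v => by positivity) (hsummable.mul_left _),
        tsum_mul_left]
      apply ENNReal.ofReal_le_ofReal
      rw [← hZ]
      linarith
    rw [Real.volume_Ioo, sub_zero] at h1
    have h3 := h1.trans h2
    rw [ENNReal.ofReal_le_ofReal_iff (by positivity)] at h3
    linarith
  obtain ⟨α, hα, hαbad⟩ := hex
  refine ⟨α, hα, fun φ hφ => vectorDiophantine_of_avoid hκ hτ hα (hΩ hφ) fun v hv j hj => ?_⟩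
  by_contra! hle
  apply hαbad
  obtain ⟨x, hxF, hx⟩ := Set.mem_iUnion₂.1 (hFsub v hv hφ)
  refine Set.mem_iUnion.2 ⟨v, Set.mem_iUnion₂.2 ⟨j, hj, Set.mem_iUnion₂.2 ⟨x, hxF, ?_⟩⟩⟩
  have hle' : |φ - α - Complex.arg ⟨v 1, v 0⟩ - j * Real.pi| ≤ 2 * δ v := hle
  rw [abs_le] at hle'
  constructor <;> linarith [hx.1, hx.2, hle'.1, hle'.2]

lemma mem_rect_iff (φ : ℝ) (p : ℝ × ℝ) (w h : ℝ) (x : ℝ × ℝ) :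
    x ∈ rect φ p w h ↔
      (p.1 * Real.cos φ + p.2 * Real.sin φ ≤ x.1 * Real.cos φ + x.2 * Real.sin φ ∧
        x.1 * Real.cos φ + x.2 * Real.sin φ ≤ p.1 * Real.cos φ + p.2 * Real.sin φ + w) ∧
      (-p.1 * Real.sin φ + p.2 * Real.cos φ ≤ -x.1 * Real.sin φ + x.2 * Real.cos φ ∧
        -x.1 * Real.sin φ + x.2 * Real.cos φ ≤ -p.1 * Real.sin φ + p.2 * Real.cos φ + h) := by
  have hcs := Real.sin_sq_add_cos_sq φ
  constructor
  · rintro ⟨⟨u, v⟩, ⟨⟨hu0, huw⟩, hv0, hvh⟩, rfl⟩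
    simp only [rot, Prod.fst_add, Prod.snd_add] at *
    have e1 : (p.1 + (u * Real.cos φ - v * Real.sin φ)) * Real.cos φ +
        (p.2 + (u * Real.sin φ + v * Real.cos φ)) * Real.sin φ =
        p.1 * Real.cos φ + p.2 * Real.sin φ + u := by linear_combination u * hcs
    have e2 : -(p.1 + (u * Real.cos φ - v * Real.sin φ)) * Real.sin φ +
        (p.2 + (u * Real.sin φ + v * Real.cos φ)) * Real.cos φ =
        -p.1 * Real.sin φ + p.2 * Real.cos φ + v := by linear_combination v * hcs
    rw [e1, e2]
    refine ⟨⟨?_, ?_⟩, ?_, ?_⟩ <;> linarith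
  · rintro ⟨⟨h1, h2⟩, h3, h4⟩
    refine ⟨((x.1 - p.1) * Real.cos φ + (x.2 - p.2) * Real.sin φ,
      -(x.1 - p.1) * Real.sin φ + (x.2 - p.2) * Real.cos φ), ⟨⟨?_, ?_⟩, ?_, ?_⟩, ?_⟩
    · dsimp only; linarith
    · dsimp only; linarith
    · dsimp only; linarith
    · dsimp only; linarith
    · ext
      · simp only [rot, Prod.fst_add]
        linear_combination (x.1 - p.1) * hcs
      · simp only [rot, Prod.snd_add]
        linear_combination (x.2 - p.2) * hcs

lemma volume_rect (φ : ℝ) (p : ℝ × ℝ) {w h : ℝ} (hw : 0 ≤ w) (hh : 0 ≤ h) :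
    (volume (rect φ p w h)).toReal = w * h := by
  set L : ℝ × ℝ →ₗ[ℝ] ℝ × ℝ := Matrix.toLin (Module.Basis.finTwoProd ℝ) (Module.Basis.finTwoProd ℝ)
    !![Real.cos φ, -Real.sin φ; Real.sin φ, Real.cos φ] with hL
  have hrot : ∀ x, rot φ x = L x := by
    intro x
    rw [hL, Matrix.toLin_finTwoProd_apply]
    simp only [rot, Prod.mk.injEq]
    constructor <;> ring
  have hdet : LinearMap.det L = 1 := by
    rw [hL, LinearMap.det_toLin, Matrix.det_fin_two_of]
    linear_combination Real.sin_sq_add_cos_sq φ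
  have himg : rect φ p w h = (fun x => p + x) '' (L '' (Set.Icc 0 w ×ˢ Set.Icc 0 h)) := by
    rw [Set.image_image]
    simp only [rect, hrot]
  rw [himg, Set.image_add_left, measure_preimage_add, Measure.addHaar_image_linearMap, hdet,
    Measure.volume_eq_prod, Measure.prod_prod, Real.volume_Icc, Real.volume_Icc]
  simp [hw, hh]

lemma unitSq_eq_rect : unitSq = rect 0 (0, 0) 1 1 := by
  ext x
  rw [mem_rect_iff]
  rw [unitSq, Set.mem_prod, Set.mem_Icc, Set.mem_Icc]
  simp

lemma side_le_two_of_rect_subset {φ : ℝ} {p : ℝ × ℝ} {w h : ℝ} (hw : 0 ≤ w) (hh : 0 ≤ h)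
    (hsub : rect φ p w h ⊆ unitSq) : w ≤ 2 ∧ h ≤ 2 := by
  have hcs := Real.sin_sq_add_cos_sq φ
  have m : ∀ u v : ℝ, 0 ≤ u → u ≤ w → 0 ≤ v → v ≤ h → p + rot φ (u, v) ∈ unitSq :=
    fun u v h1 h2 h3 h4 => hsub ⟨(u, v), ⟨⟨h1, h2⟩, h3, h4⟩, rfl⟩
  have m0 := m 0 0 le_rfl hw le_rfl hh
  have mw := m w 0 hw le_rfl le_rfl hh
  have mh := m 0 h le_rfl hw hh le_rfl
  simp only [unitSq, rot, Set.mem_prod, Set.mem_Icc, Prod.fst_add, Prod.snd_add] at m0 mw mh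
  have sq_le : ∀ t : ℝ, -1 ≤ t → t ≤ 1 → t ^ 2 ≤ 1 := fun t h1 h2 => by nlinarith
  constructor
  · have h1 := sq_le (w * Real.cos φ) (by linarith) (by linarith)
    have h2 := sq_le (w * Real.sin φ) (by linarith) (by linarith)
    have h3 : w ^ 2 ≤ 2 := by
      have : w ^ 2 = (w * Real.cos φ) ^ 2 + (w * Real.sin φ) ^ 2 := by
        linear_combination -w ^ 2 * hcs
      linarith
    nlinarith
  · have h1 := sq_le (h * Real.cos φ) (by linarith) (by linarith)
    have h2 := sq_le (h * Real.sin φ) (by linarith) (by linarith)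
    have h3 : h ^ 2 ≤ 2 := by
      have : h ^ 2 = (h * Real.cos φ) ^ 2 + (h * Real.sin φ) ^ 2 := by
        linear_combination -h ^ 2 * hcs
      linarith
    nlinarith

/-- The integer lattice, rotated by `α` and scaled by `r⁻¹`. -/
def latticePoint (r α : ℝ) (z : ℤ × ℤ) : ℝ × ℝ := r⁻¹ • rot α (z.1, z.2)

lemma latticePoint_injective {r : ℝ} (hr : 0 < r) (α : ℝ) :
    Function.Injective (latticePoint r α) := by
  have hcs := Real.sin_sq_add_cos_sq α
  intro z z' h
  have h' := smul_right_injective (ℝ × ℝ) (inv_ne_zero hr.ne') h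
  simp only [rot, Prod.mk.injEq] at h'
  obtain ⟨h1, h2⟩ := h'
  have e1 : (z.1 : ℝ) = z'.1 := by
    linear_combination Real.cos α * h1 + Real.sin α * h2 + ((z'.1 : ℝ) - z.1) * hcs
  have e2 : (z.2 : ℝ) = z'.2 := by
    linear_combination Real.cos α * h2 - Real.sin α * h1 + ((z'.2 : ℝ) - z.2) * hcs
  exact Prod.ext (by exact_mod_cast e1) (by exact_mod_cast e2)

lemma latticePoint_mem_rect_iff {r : ℝ} (hr : 0 < r) (α φ : ℝ) (p : ℝ × ℝ) (w h : ℝ)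
    (z : ℤ × ℤ) :
    latticePoint r α z ∈ rect φ p w h ↔
      z ∈ latticeRect (Real.cos (φ - α)) (Real.sin (φ - α))
        (r * (p.1 * Real.cos φ + p.2 * Real.sin φ)) (r * (-p.1 * Real.sin φ + p.2 * Real.cos φ))
        (r * w) (r * h) := by
  rw [mem_rect_iff]
  simp only [latticePoint, rot, latticeRect, Set.mem_ofPred_eq, Prod.smul_fst, Prod.smul_snd,
    smul_eq_mul]
  have e1 : r⁻¹ * (z.1 * Real.cos α - z.2 * Real.sin α) * Real.cos φ +
      r⁻¹ * (z.1 * Real.sin α + z.2 * Real.cos α) * Real.sin φ =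
      (Real.cos (φ - α) * z.1 + Real.sin (φ - α) * z.2) / r := by
    rw [Real.cos_sub, Real.sin_sub]; ring
  have e2 : -(r⁻¹ * (z.1 * Real.cos α - z.2 * Real.sin α)) * Real.sin φ +
      r⁻¹ * (z.1 * Real.sin α + z.2 * Real.cos α) * Real.cos φ =
      (-Real.sin (φ - α) * z.1 + Real.cos (φ - α) * z.2) / r := by
    rw [Real.cos_sub, Real.sin_sub]; ring
  rw [e1, e2, le_div_iff₀ hr, div_le_iff₀ hr, le_div_iff₀ hr, div_le_iff₀ hr]
  constructor <;> rintro ⟨⟨h1, h2⟩, h3, h4⟩ <;> refine ⟨⟨?_, ?_⟩, ?_, ?_⟩ <;> linarith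

lemma image_latticeRect_eq {r : ℝ} (hr : 0 < r) (α φ : ℝ) (p : ℝ × ℝ) (w h : ℝ) :
    latticePoint r α '' latticeRect (Real.cos (φ - α)) (Real.sin (φ - α))
        (r * (p.1 * Real.cos φ + p.2 * Real.sin φ)) (r * (-p.1 * Real.sin φ + p.2 * Real.cos φ))
        (r * w) (r * h) = Set.range (latticePoint r α) ∩ rect φ p w h := by
  ext x
  constructor
  · rintro ⟨z, hz, rfl⟩
    exact ⟨⟨z, rfl⟩, (latticePoint_mem_rect_iff hr α φ p w h z).2 hz⟩
  · rintro ⟨⟨z, rfl⟩, hz⟩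
    exact ⟨z, (latticePoint_mem_rect_iff hr α φ p w h z).1 hz, rfl⟩

lemma unitSq_infinite : unitSq.Infinite :=
  Set.Infinite.prod_left (Set.Icc_infinite zero_lt_one) ⟨0, by simp⟩

/-- A finite set of points can be adjusted to any given cardinality, changing the counts in all
regions by at most the change in cardinality. -/
lemma exists_card_eq_of_infinite {X : Type*} {U : Set X} (hU : U.Infinite) {Q : Finset X}
    (hQ : (Q : Set X) ⊆ U) (N : ℕ) :
    ∃ P : Finset X, P.card = N ∧ (P : Set X) ⊆ U ∧ ∀ R : Set X,
      |(((P : Set X) ∩ R).ncard : ℝ) - ((Q : Set X) ∩ R).ncard| ≤ |(Q.card : ℝ) - N| := by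
  classical
  have key : ∀ {A B : Finset X}, A ⊆ B → ∀ R : Set X,
      |(((B : Set X) ∩ R).ncard : ℝ) - ((A : Set X) ∩ R).ncard| ≤ (B.card : ℝ) - A.card := by
    intro A B hAB R
    have hfin : ((B : Set X) ∩ R).Finite := B.finite_toSet.inter_of_left R
    have h1 : ((A : Set X) ∩ R).ncard ≤ ((B : Set X) ∩ R).ncard :=
      Set.ncard_le_ncard (Set.inter_subset_inter_left _ (by exact_mod_cast hAB)) hfin
    have h2 : ((B : Set X) ∩ R).ncard ≤ ((A : Set X) ∩ R).ncard + (B \ A).card := by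
      rw [← Set.ncard_coe_finset (B \ A)]
      refine (Set.ncard_le_ncard (t := ((A : Set X) ∩ R) ∪ ((B \ A : Finset X) : Set X)) ?_
        ((A.finite_toSet.inter_of_left R).union (Finset.finite_toSet _))).trans
        (Set.ncard_union_le _ _)
      rintro x ⟨hx, hxR⟩
      by_cases hxA : x ∈ A
      · exact Or.inl ⟨hxA, hxR⟩
      · exact Or.inr (by simpa using ⟨hx, hxA⟩)
    have h3 := Finset.card_sdiff_add_card_eq_card hAB
    have h1' : (((A : Set X) ∩ R).ncard : ℝ) ≤ ((B : Set X) ∩ R).ncard := by exact_mod_cast h1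
    have h2' : (((B : Set X) ∩ R).ncard : ℝ) ≤ ((A : Set X) ∩ R).ncard + (B \ A).card := by
      exact_mod_cast h2
    have h3' : ((B \ A).card : ℝ) + A.card = B.card := by exact_mod_cast h3
    rw [abs_of_nonneg (by linarith)]
    linarith
  rcases le_total N Q.card with h | h
  · obtain ⟨P, hPQ, hP⟩ := Finset.exists_subset_card_eq h
    refine ⟨P, hP, subset_trans (by exact_mod_cast hPQ) hQ, fun R => ?_⟩
    rw [abs_sub_comm]
    refine (key hPQ R).trans ?_
    rw [hP]
    exact le_abs_self _
  · obtain ⟨E, hEU, hE⟩ := (hU.sdiff Q.finite_toSet).exists_subset_card_eq (N - Q.card)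
    have hdisj : Disjoint Q E := by
      rw [Finset.disjoint_left]
      intro x hx hxE
      exact (hEU hxE).2 hx
    have hcard : (Q ∪ E).card = N := by rw [Finset.card_union_of_disjoint hdisj, hE]; omega
    refine ⟨Q ∪ E, hcard, ?_, fun R => ?_⟩
    · rw [Finset.coe_union]
      exact Set.union_subset hQ (hEU.trans Set.sdiff_subset)
    · refine (key Finset.subset_union_left R).trans ?_
      rw [hcard, abs_sub_comm]
      exact le_abs_self _

lemma exists_points_of_vectorDiophantine {κ τ α : ℝ} {Ω : Set ℝ} (hκ : 0 < κ) (hκ1 : κ ≤ 1)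
    (hτ : 0 < τ) (hΩ : Ω ⊆ Set.Ico 0 (Real.pi / 2)) (h0 : 0 ∈ Ω)
    (hα : α ∈ Set.Ioo 0 (Real.pi / 2))
    (hD : ∀ φ ∈ Ω, VectorDiophantine κ τ (Real.cos (φ - α)) (Real.sin (φ - α))) :
    ∃ C : ℝ, 0 < C ∧ ∀ N : ℕ, 1 ≤ N →
      ∃ P : Finset (ℝ × ℝ), P.card = N ∧ (P : Set (ℝ × ℝ)) ⊆ unitSq ∧
        ∀ (φ : ℝ) (p : ℝ × ℝ) (w h : ℝ), φ ∈ Ω → 0 ≤ w → 0 ≤ h → rect φ p w h ⊆ unitSq →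
          |(((P : Set (ℝ × ℝ)) ∩ rect φ p w h).ncard : ℝ) -
              (N : ℝ) * (volume (rect φ p w h)).toReal|
            ≤ C * (N : ℝ) ^ (τ / (2 * (1 + τ))) := by
  obtain ⟨C, hC, hcount⟩ := exists_abs_ncard_latticeRect_sub_le hκ hκ1 hτ
  refine ⟨2 * (C * 2 ^ (τ / (1 + τ))), by positivity, fun N hN => ?_⟩
  have hNR : (1 : ℝ) ≤ N := by exact_mod_cast hN
  set r := Real.sqrt N with hr
  have hr1 : 1 ≤ r := by rw [hr, Real.one_le_sqrt]; exact hNR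
  have hr0 : 0 < r := by linarith
  have hrr : r * r = N := Real.mul_self_sqrt (by linarith)
  set E := C * 2 ^ (τ / (1 + τ)) * (N : ℝ) ^ (τ / (2 * (1 + τ))) with hE
  have hpow : C * (2 * r) ^ (τ / (1 + τ)) = E := by
    rw [Real.mul_rpow (by norm_num) hr0.le, hE, hr, Real.sqrt_eq_rpow,
      ← Real.rpow_mul (by linarith)]
    have : 1 / 2 * (τ / (1 + τ)) = τ / (2 * (1 + τ)) := by field_simp
    rw [this]
    ring
  have main : ∀ (φ : ℝ) (p : ℝ × ℝ) (w h : ℝ), φ ∈ Ω → 0 ≤ w → 0 ≤ h → rect φ p w h ⊆ unitSq →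
      (Set.range (latticePoint r α) ∩ rect φ p w h).Finite ∧
      |((Set.range (latticePoint r α) ∩ rect φ p w h).ncard : ℝ) - N * (w * h)| ≤ E := by
    intro φ p w h hφ hw hh hsub
    obtain ⟨hw2, hh2⟩ := side_le_two_of_rect_subset hw hh hsub
    have hcos : 0 < Real.cos (φ - α) := Real.cos_pos_of_mem_Ioo
      ⟨by linarith [(hΩ hφ).1, hα.2], by linarith [(hΩ hφ).2, hα.1]⟩
    obtain ⟨hfin, hle⟩ := hcount _ _ hcos (Real.cos_sq_add_sin_sq _) (hD φ hφ)
      (r * (p.1 * Real.cos φ + p.2 * Real.sin φ)) (r * (-p.1 * Real.sin φ + p.2 * Real.cos φ))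
      (r * w) (r * h) (2 * r) (by positivity) (by positivity) (by nlinarith) (by nlinarith)
      (by linarith)
    rw [← image_latticeRect_eq hr0, Set.ncard_image_of_injective _ (latticePoint_injective hr0 α)]
    refine ⟨hfin.image _, ?_⟩
    rw [← hpow]
    convert hle using 2
    rw [← hrr]
    ring
  have hsq := main 0 (0, 0) 1 1 h0 zero_le_one zero_le_one unitSq_eq_rect.ge
  rw [← unitSq_eq_rect] at hsq
  obtain ⟨hfin, hsqle⟩ := hsq
  set Q := hfin.toFinset with hQ
  have hQcoe : (Q : Set (ℝ × ℝ)) = Set.range (latticePoint r α) ∩ unitSq := hfin.coe_toFinset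
  obtain ⟨P, hPcard, hPsub, hP⟩ := exists_card_eq_of_infinite unitSq_infinite (Q := Q)
    (by rw [hQcoe]; exact Set.inter_subset_right) N
  refine ⟨P, hPcard, hPsub, fun φ p w h hφ hw hh hsub => ?_⟩
  have hQN : |(Q.card : ℝ) - N| ≤ E := by
    rw [← Set.ncard_coe_finset Q, hQcoe]
    simpa using hsqle
  have hQR : (Q : Set (ℝ × ℝ)) ∩ rect φ p w h = Set.range (latticePoint r α) ∩ rect φ p w h := by
    rw [hQcoe, Set.inter_assoc, Set.inter_eq_right.2 hsub]
  have h1 := (hP (rect φ p w h)).trans hQN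
  have h2 := (main φ p w h hφ hw hh hsub).2
  rw [hQR] at h1
  rw [volume_rect φ p hw hh]
  have h3 : 2 * (C * 2 ^ (τ / (1 + τ))) * (N : ℝ) ^ (τ / (2 * (1 + τ))) = E + E := by
    rw [hE]; ring
  rw [h3]
  refine (abs_sub_le _ _ _).trans (add_le_add h1 h2)

lemma div_two_mul_add_le {τ ε : ℝ} (hτ : 0 ≤ τ) (hε : 0 ≤ ε) :
    (τ + ε) / (2 * (1 + (τ + ε))) ≤ τ / (2 * (τ + 1)) + ε := by
  rw [div_add' _ _ _ (by positivity), div_le_div_iff₀ (by positivity) (by positivity)]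
  nlinarith [mul_nonneg hτ hε, mul_nonneg (mul_nonneg hτ hε) hε, mul_nonneg (mul_nonneg hτ hτ) hε,
    mul_nonneg hε hε]

lemma MinkowskiBound.cover_insert_zero {Ω : Set ℝ} {d s : ℝ} (h : MinkowskiBound Ω d) (hds : d < s)
    (hs : 0 ≤ s) : ∃ D : ℝ, 0 ≤ D ∧ ∀ δ : ℝ, 0 < δ → δ < 1 → ∃ F : Finset ℝ,
      (F.card : ℝ) ≤ D * δ ^ (-s) ∧ insert 0 Ω ⊆ ⋃ x ∈ F, Set.Icc x (x + δ) := by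
  classical
  obtain ⟨D, hD⟩ := h s hds
  refine ⟨|D| + 1, by positivity, fun δ hδ hδ1 => ?_⟩
  obtain ⟨F, hF, hsub⟩ := hD δ hδ hδ1
  have hone : 1 ≤ δ ^ (-s) := Real.one_le_rpow_of_pos_of_le_one_of_nonpos hδ hδ1.le (by linarith)
  refine ⟨insert 0 F, ?_, ?_⟩
  · have h1 : ((insert 0 F).card : ℝ) ≤ F.card + 1 := by exact_mod_cast Finset.card_insert_le 0 F
    have h2 : D * δ ^ (-s) ≤ |D| * δ ^ (-s) := by gcongr; exact le_abs_self D
    linarith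
  · rw [Finset.set_biUnion_insert]
    refine Set.insert_subset (Or.inl ⟨le_rfl, by linarith⟩) (hsub.trans Set.subset_union_right)

/-- If `Ω ⊆ (0, π/2)` has upper Minkowski dimension at most `d < 1` and
`τ = 2/(1-d)² - 2`, then `D_Ω(N) ≲ N^{τ/(2(τ+1)) + ε}` for every `ε > 0`. -/
theorem directional_discrepancy_minkowski
    (d : ℝ) (hd0 : 0 ≤ d) (hd1 : d < 1) (Ω : Set ℝ)
    (hΩ : Ω ⊆ Set.Ioo 0 (Real.pi / 2)) (hmink : MinkowskiBound Ω d)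
    (τ : ℝ) (hτ : τ = 2 / (1 - d) ^ 2 - 2) (ε : ℝ) (hε : 0 < ε) :
    ∃ C : ℝ, 0 < C ∧ ∀ N : ℕ, 2 ≤ N →
      ∃ P : Finset (ℝ × ℝ), P.card = N ∧ (P : Set (ℝ × ℝ)) ⊆ unitSq ∧
        ∀ (φ : ℝ) (p : ℝ × ℝ) (w h : ℝ), φ ∈ Ω → 0 < w → 0 < h →
          rect φ p w h ⊆ unitSq →
          |(((P : Set (ℝ × ℝ)) ∩ rect φ p w h).ncard : ℝ) -
              (N : ℝ) * (volume (rect φ p w h)).toReal|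
            ≤ C * (N : ℝ) ^ (τ / (2 * (τ + 1)) + ε) := by

  have hd1' : 0 < 1 - d := by linarith
  have hτ0 : 0 ≤ τ := by
    rw [hτ, sub_nonneg, le_div_iff₀ (by positivity)]
    nlinarith
  set τ' := τ + ε with hτ'
  have hτ'0 : 0 < τ' := by linarith
  have hdτ : d < 1 - 2 / (2 + τ') := by
    have h1 : 2 / (1 - d) ≤ 2 / (1 - d) ^ 2 :=
      div_le_div_of_nonneg_left (by norm_num) (by positivity) (by nlinarith)
    have h2 : 2 / (1 - d) < 2 + τ' := by rw [hτ', hτ]; linarith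
    rw [div_lt_iff₀ hd1'] at h2
    rw [lt_sub_comm, div_lt_iff₀ (by positivity)]
    linarith
  obtain ⟨s, hds, hs⟩ := exists_between hdτ
  have hs1 : s < 1 := by have : 0 < 2 / (2 + τ') := by positivity
                         linarith
  have hst : 2 < (2 + τ') * (1 - s) := by
    rw [lt_sub_comm, div_lt_iff₀ (by positivity)] at hs
    linarith
  obtain ⟨D, hD0, hcover⟩ := hmink.cover_insert_zero hds (hd0.trans hds.le)
  have hΩ' : insert 0 Ω ⊆ Set.Ico 0 (Real.pi / 2) :=
    Set.insert_subset ⟨le_rfl, by positivity⟩ (hΩ.trans Set.Ioo_subset_Ico_self)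
  obtain ⟨κ, hκ, hκ1, α, hα, hdio⟩ :=
    exists_vectorDiophantine_rotation hΩ' hs1 hτ'0 hst hD0 hcover
  obtain ⟨C, hC, hpts⟩ := exists_points_of_vectorDiophantine hκ hκ1 hτ'0 hΩ'
    (Set.mem_insert 0 Ω) hα hdio
  refine ⟨C, hC, fun N hN => ?_⟩
  obtain ⟨P, hPcard, hPsub, hP⟩ := hpts N (by omega)
  refine ⟨P, hPcard, hPsub, fun φ p w h hφ hw hh hsub => ?_⟩
  refine (hP φ p w h (Set.mem_insert_of_mem 0 hφ) hw.le hh.le hsub).trans ?_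
  have hN1 : (1 : ℝ) ≤ N := by exact_mod_cast (by omega : 1 ≤ N)
  gcongr
  exact div_two_mul_add_le hτ0 hε.le

end
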